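/- Let ~ be an indistinguishability relation on Γ*, λ an information-consistent absorbing coloring, and h : Γ* → P a rectangular morphism. Then P_∃ ⊆ Y* ∩ P: every existentially winning abstract state belongs to the fixpoint Y*. -/

import Mathlib

open MeasureTheory
open scoped Classical

section Games

variable {Γ A P : Type}

/-- Histories are finite words over the alphabet of moves. -/
abbrev Hist (Γ : Type) := List Γ

/-- The information set of a history: all histories indistinguishable from it. -/
def InfoSet (sim : Hist Γ → Hist Γ → Prop) (τ : Hist Γ) : Set (Hist Γ) := {τ' | sim τ' τ}

/-- An indistinguishability relation: an equivalence relation such that related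
histories have the same length, the relation is prefix-closed and actions are visible. -/
structure IsIndist (act : Γ → A) (sim : Hist Γ → Hist Γ → Prop) : Prop where
  equiv : Equivalence sim
  length_eq : ∀ τ τ' : Hist Γ, sim τ τ' → τ.length = τ'.length
  prefix_act : ∀ (τ τ' : Hist Γ) (c c' : Γ),
    sim (τ ++ [c]) (τ' ++ [c']) → sim τ τ' ∧ act c = act c'

/-- A function on histories is information consistent if it is constant on information sets. -/
def InfoConsistent {C : Type} (sim : Hist Γ → Hist Γ → Prop) (lam : Hist Γ → C) : Prop :=
  ∀ τ τ' : Hist Γ, sim τ τ' → lam τ = lam τ'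

/-- The coloring is absorbing: once a winning history, always winning. -/
def Absorbing (lam : Hist Γ → Bool) : Prop :=
  ∀ (τ : Hist Γ) (c : Γ), lam τ = true → lam (τ ++ [c]) = true

/-- A rectangular morphism for the game. -/
structure IsRectMorphism (sim : Hist Γ → Hist Γ → Prop) (lam : Hist Γ → Bool)
    (h : Hist Γ → P) : Prop where
  surj : Function.Surjective h
  rect : ∀ τ τ' : Hist Γ, h τ = h τ' → h '' InfoSet sim τ = h '' InfoSet sim τ'
  morph : ∀ (τ τ' : Hist Γ) (c : Γ), h τ = h τ' → h (τ ++ [c]) = h (τ' ++ [c])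
  refines : ∀ τ τ' : Hist Γ, h τ = h τ' → lam τ = lam τ'

/-- The relation ≈ on abstract states: ≈ = {(h τ, h τ') | τ ~ τ'}. -/
def approx (sim : Hist Γ → Hist Γ → Prop) (h : Hist Γ → P) (p p' : P) : Prop :=
  ∃ τ τ' : Hist Γ, sim τ τ' ∧ h τ = p ∧ h τ' = p'

/-- The extension of ≈ to P ⊕ (P × A). -/
def approxS (sim : Hist Γ → Hist Γ → Prop) (h : Hist Γ → P) :
    (P ⊕ P × A) → (P ⊕ P × A) → Prop
  | Sum.inl p, Sum.inl p' => approx sim h p p'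
  | Sum.inr (p, a), Sum.inr (p', a') => approx sim h p p' ∧ a = a'
  | _, _ => False

/-- The intr of a set under an equivalence relation. -/
def intr {S : Type} (r : S → S → Prop) (T : Set S) : Set S :=
  {t | ∀ t', r t' t → t' ∈ T}

/-- The set P_F of target (final) abstract states. -/
def targetSet (lam : Hist Γ → Bool) (h : Hist Γ → P) : Set P :=
  {p | ∃ τ : Hist Γ, h τ = p ∧ lam τ = true}

/-- The set P_F viewed inside P ⊕ (P × A). -/
def targetS (A : Type) (lam : Hist Γ → Bool) (h : Hist Γ → P) : Set (P ⊕ P × A) :=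
  Sum.inl '' targetSet lam h

/-- Membership in the predecessor operator. -/
def PreMem (act : Γ → A) (δP : P → Γ → P) (X : Set (P ⊕ P × A)) : (P ⊕ P × A) → Prop
  | Sum.inl p => ∃ a : A, Sum.inr (p, a) ∈ X
  | Sum.inr (p, a) => ∀ c : Γ, act c = a → Sum.inl (δP p c) ∈ X

/-- The predecessor operator Pre on subsets of P ⊕ (P × A). -/
def Pre (act : Γ → A) (δP : P → Γ → P) (X : Set (P ⊕ P × A)) : Set (P ⊕ P × A) :=
  {s | PreMem act δP X s}

lemma Pre_mono (act : Γ → A) (δP : P → Γ → P) : Monotone (Pre act δP) := by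
  intro X Y hXY s hs
  cases s with
  | inl p =>
      obtain ⟨a, ha⟩ := hs
      exact ⟨a, hXY ha⟩
  | inr pa =>
      obtain ⟨p, a⟩ := pa
      exact fun c hc => hXY (hs c hc)

/-- The inner (monotone) operator X ↦ int≈(Y) ∩ (Pre(X) ∪ P_F). -/
def innerOp (sim : Hist Γ → Hist Γ → Prop) (h : Hist Γ → P) (act : Γ → A)
    (δP : P → Γ → P) (lam : Hist Γ → Bool) (Y : Set (P ⊕ P × A)) :
    Set (P ⊕ P × A) →o Set (P ⊕ P × A) :=
  ⟨fun X => intr (approxS sim h) Y ∩ (Pre act δP X ∪ targetS A lam h),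
   fun _ _ hXX' =>
     Set.inter_subset_inter le_rfl (Set.union_subset_union (Pre_mono act δP hXX') le_rfl)⟩

/-- The outer (monotone) operator Y ↦ μX. int≈(Y) ∩ (Pre(X) ∪ P_F). -/
def outerOp (sim : Hist Γ → Hist Γ → Prop) (h : Hist Γ → P) (act : Γ → A)
    (δP : P → Γ → P) (lam : Hist Γ → Bool) :
    Set (P ⊕ P × A) →o Set (P ⊕ P × A) :=
  ⟨fun Y => OrderHom.lfp (innerOp sim h act δP lam Y),
   by
     intro Y Y' hYY'
     exact OrderHom.lfp.monotone fun X =>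
       Set.inter_subset_inter (fun t ht t' hr => hYY' (ht t' hr)) le_rfl⟩

/-- The fixpoint Y* = νY. μX. int≈(Y) ∩ (Pre(X) ∪ P_F). -/
def Ystar (sim : Hist Γ → Hist Γ → Prop) (h : Hist Γ → P) (act : Γ → A)
    (δP : P → Γ → P) (lam : Hist Γ → Bool) : Set (P ⊕ P × A) :=
  OrderHom.gfp (outerOp sim h act δP lam)

/-- A probability distribution on a finite type. -/
structure PDist (X : Type) [Fintype X] where
  f : X → ℝ
  nonneg : ∀ x, 0 ≤ f x
  sum_one : ∑ x, f x = 1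

variable [Fintype Γ] [Fintype A]

/-- A strategy of the player is information consistent. -/
def IsPlayerStrat (sim : Hist Γ → Hist Γ → Prop) (α : Hist Γ → PDist A) : Prop :=
  ∀ τ τ' : Hist Γ, sim τ τ' → α τ = α τ'

/-- A strategy of the environment only plays moves supported by the given action. -/
def IsEnvStrat (act : Γ → A) (β : Hist Γ → A → PDist Γ) : Prop :=
  ∀ (τ : Hist Γ) (a : A) (c : Γ), 0 < (β τ a).f c → act c = a

/-- Plays are infinite sequences of moves. -/
abbrev Play (Γ : Type) := ℕ → Γ

/-- The cylinder set spanned by a finite history. -/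
def Cyl (ρ : List Γ) : Set (Play Γ) := {π | ∀ i : Fin ρ.length, π i.1 = ρ.get i}

/-- The σ-algebra on plays generated by cylinder sets. -/
instance playMS : MeasurableSpace (Play Γ) :=
  .generateFrom {s | ∃ ρ : List Γ, s = Cyl ρ}

/-- The probability that the game, started after history τ, follows a given
further sequence of moves, under strategies α and β. -/
noncomputable def extProb (act : Γ → A) (α : Hist Γ → PDist A) (β : Hist Γ → A → PDist Γ) :
    Hist Γ → List Γ → ℝ
  | _, [] => 1
  | τ, c :: l => (α τ).f (act c) * (β τ (act c)).f c * extProb act α β (τ ++ [c]) l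

/-- μ is the probability measure Pr_τ^{α,β}: its value on every cylinder set is prescribed. -/
def IsPrMeasure (act : Γ → A) (α : Hist Γ → PDist A) (β : Hist Γ → A → PDist Γ)
    (τ : Hist Γ) (μ : Measure (Play Γ)) : Prop :=
  IsProbabilityMeasure μ ∧
  ∀ ρ : Hist Γ, μ (Cyl ρ) =
    if ρ <+: τ then 1
    else if τ <+: ρ then ENNReal.ofReal (extProb act α β τ (ρ.drop τ.length))
    else 0

/-- The reachability event: the set of plays having a finite prefix of color 1. -/
def ReachEvent (lam : Hist Γ → Bool) : Set (Play Γ) :=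
  {π | ∃ n : ℕ, lam (List.ofFn fun i : Fin n => π i.1) = true}

/-- The strategy α is almost-sure winning from the information set [τ]~ for reachability. -/
def ASWinFrom (act : Γ → A) (sim : Hist Γ → Hist Γ → Prop) (lam : Hist Γ → Bool)
    (α : Hist Γ → PDist A) (τ : Hist Γ) : Prop :=
  ∀ τ' : Hist Γ, τ' ∈ InfoSet sim τ →
    ∀ β : Hist Γ → A → PDist Γ, IsEnvStrat act β →
      ∀ μ : Measure (Play Γ), IsPrMeasure act α β τ' μ → μ (ReachEvent lam) = 1

/-- The set P_∃ of existentially winning abstract states. -/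
def Pexists (act : Γ → A) (sim : Hist Γ → Hist Γ → Prop) (lam : Hist Γ → Bool)
    (h : Hist Γ → P) : Set P :=
  {p | ∃ τ : Hist Γ, h τ = p ∧
    ∃ α : Hist Γ → PDist A, IsPlayerStrat sim α ∧ ASWinFrom act sim lam α τ}

/-- The set P_∀ of universally winning abstract states. -/
def Pforall (act : Γ → A) (sim : Hist Γ → Hist Γ → Prop) (lam : Hist Γ → Bool)
    (h : Hist Γ → P) : Set P :=
  {p | ∀ τ : Hist Γ, h τ = p →
    ∃ α : Hist Γ → PDist A, IsPlayerStrat sim α ∧ ASWinFrom act sim lam α τ}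

end Games


section Aux

variable {Γ A P : Type} [Fintype Γ] [Fintype A]

/-- Point mass. -/
noncomputable def pointDist (c : Γ) : PDist Γ where
  f x := if x = c then 1 else 0
  nonneg x := by split_ifs <;> norm_num
  sum_one := by simp

/-- The law of the next move. -/
noncomputable def stepDist (act : Γ → A) (α : Hist Γ → PDist A) (β : Hist Γ → A → PDist Γ)
    (hβ : IsEnvStrat act β) (τ : Hist Γ) : PDist Γ where
  f c := (α τ).f (act c) * (β τ (act c)).f c
  nonneg c := mul_nonneg ((α τ).nonneg _) ((β τ _).nonneg _)
  sum_one := by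
    have h1 : ∀ c : Γ, (α τ).f (act c) * (β τ (act c)).f c
        = ∑ a, (α τ).f a * (β τ a).f c := by
      intro c
      rw [Finset.sum_eq_single (act c)]
      · intro a _ ha
        have : (β τ a).f c = 0 := by
          by_contra hne
          have hpos : 0 < (β τ a).f c := lt_of_le_of_ne ((β τ a).nonneg c) (Ne.symm hne)
          exact ha (hβ τ a c hpos).symm
        simp [this]
      · simp
    simp_rw [h1]
    rw [Finset.sum_comm]
    simp_rw [← Finset.mul_sum, PDist.sum_one, mul_one]
    exact (α τ).sum_one

/-- Probability of following `l` after `σ` when the next-move law is `w`. -/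
noncomputable def prW (w : Hist Γ → PDist Γ) : Hist Γ → List Γ → ℝ
  | _, [] => 1
  | σ, c :: l => (w σ).f c * prW w (σ ++ [c]) l

lemma prW_eq_prod (w : Hist Γ → PDist Γ) (l : List Γ) : ∀ σ : Hist Γ,
    prW w σ l = ∏ i : Fin l.length, (w (σ ++ l.take i)).f (l.get i) := by
  induction l with
  | nil => intro σ; simp [prW]
  | cons c l ih =>
    intro σ
    rw [prW, ih]
    simp only [List.length_cons, Fin.prod_univ_succ]
    simp

/-- The measure associated with a distribution. -/
noncomputable def distMeasure (d : PDist Γ) : @Measure Γ ⊤ :=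
  letI : MeasurableSpace Γ := ⊤
  ∑ c, ENNReal.ofReal (d.f c) • Measure.dirac c

lemma distMeasure_singleton (d : PDist Γ) (c : Γ) :
    distMeasure d {c} = ENNReal.ofReal (d.f c) := by
  letI : MeasurableSpace Γ := ⊤
  simp only [distMeasure, Measure.coe_finset_sum, Finset.sum_apply, Measure.smul_apply,
    smul_eq_mul]
  rw [Finset.sum_eq_single c]
  · simp
  · intro b _ hb
    simp [hb]
  · simp

lemma distMeasure_prob (d : PDist Γ) : @IsProbabilityMeasure Γ ⊤ (distMeasure d) := by
  letI : MeasurableSpace Γ := ⊤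
  constructor
  simp only [distMeasure, Measure.coe_finset_sum, Finset.sum_apply, Measure.smul_apply,
    smul_eq_mul, measure_univ, mul_one]
  rw [← ENNReal.ofReal_sum_of_nonneg (fun i _ => d.nonneg i), d.sum_one, ENNReal.ofReal_one]

/-- History generated by a deterministic rule. -/
def histF (F : Hist Γ → Γ) : ℕ → Hist Γ
  | 0 => []
  | n + 1 => histF F n ++ [F (histF F n)]

/-- Play generated by a deterministic rule. -/
def playF (F : Hist Γ → Γ) : Play Γ := fun n => F (histF F n)

lemma mem_Cyl_append (ρ : List Γ) (c : Γ) (π : Play Γ) :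
    π ∈ Cyl (ρ ++ [c]) ↔ π ∈ Cyl ρ ∧ π ρ.length = c := by
  simp only [Cyl, Set.mem_setOf_eq]
  constructor
  · intro hp
    refine ⟨fun i => ?_, ?_⟩
    · have := hp ⟨i.1, by have := i.2; rw [List.length_append]; omega⟩
      simpa [List.getElem_append_left i.2] using this
    · have := hp ⟨ρ.length, by simp⟩
      simpa using this
  · rintro ⟨h1, h2⟩ ⟨i, hi⟩
    by_cases hlt : i < ρ.length
    · simpa [List.getElem_append_left hlt] using h1 ⟨i, hlt⟩
    · have : i = ρ.length := by simp at hi; omega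
      subst this
      simpa using h2

lemma mem_Cyl_iff_ofFn (ρ : List Γ) (π : Play Γ) :
    π ∈ Cyl ρ ↔ (List.ofFn fun i : Fin ρ.length => π i.1) = ρ := by
  constructor
  · intro hp
    apply List.ext_getElem (by simp)
    intro i h1 h2
    simpa using hp ⟨i, h2⟩
  · intro hp i
    have := List.getElem_of_eq hp.symm i.2
    simpa using this.symm

lemma ofFn_playF (F : Hist Γ → Γ) (n : ℕ) :
    (List.ofFn fun i : Fin n => playF F i.1) = histF F n := by
  induction n with
  | zero => simp [histF]
  | succ n ih =>
    rw [List.ofFn_succ_last, histF, ← ih]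
    simp only [Fin.val_castSucc, Fin.val_last]
    rw [ih]; rfl

lemma playF_mem_Cyl_append (F : Hist Γ → Γ) (ρ : List Γ) (c : Γ) :
    playF F ∈ Cyl (ρ ++ [c]) ↔ playF F ∈ Cyl ρ ∧ F ρ = c := by
  rw [mem_Cyl_append]
  refine and_congr_right fun hp => ?_
  rw [mem_Cyl_iff_ofFn, ofFn_playF] at hp
  rw [playF, hp]

lemma playF_mem_Cyl (F : Hist Γ → Γ) (ρ : List Γ) :
    playF F ∈ Cyl ρ ↔ ∀ i : Fin ρ.length, F (ρ.take i) = ρ.get i := by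
  induction ρ using List.reverseRecOn with
  | nil => simp [Cyl]
  | append_singleton ρ c ih =>
    rw [playF_mem_Cyl_append, ih]
    constructor
    · rintro ⟨h1, h2⟩ ⟨i, hi⟩
      by_cases hlt : i < ρ.length
      · have := h1 ⟨i, hlt⟩
        simpa [List.getElem_append_left hlt, List.take_append_of_le_length hlt.le] using this
      · have : i = ρ.length := by simp at hi; omega
        subst this
        simpa using h2
    · intro hp
      refine ⟨fun i => ?_, ?_⟩
      · have := hp ⟨i.1, by have := i.2; rw [List.length_append]; omega⟩
        simpa [List.getElem_append_left i.2, List.take_append_of_le_length i.2.le] using this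
      · have := hp ⟨ρ.length, by simp⟩
        simpa using this

lemma exists_measure (w : Hist Γ → PDist Γ) : ∃ μ : Measure (Play Γ), IsProbabilityMeasure μ ∧
    ∀ ρ, μ (Cyl ρ) = ENNReal.ofReal (prW w [] ρ) := by
  letI : MeasurableSpace Γ := ⊤
  haveI : DiscreteMeasurableSpace Γ := ⟨fun _ => trivial⟩
  haveI : ∀ σ, IsProbabilityMeasure (distMeasure (w σ)) := fun σ => distMeasure_prob (w σ)
  let ν : Measure (Hist Γ → Γ) := Measure.infinitePi (fun σ => distMeasure (w σ))
  have hpre : ∀ ρ : List Γ, playF ⁻¹' (Cyl ρ) =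
      Set.pi ((Finset.univ.image (fun i : Fin ρ.length => ρ.take i.1) : Finset (Hist Γ)) :
        Set (Hist Γ)) (fun σ => {c | ρ[σ.length]? = some c}) := by
    intro ρ
    ext F
    rw [Set.mem_preimage, playF_mem_Cyl]
    simp only [Set.mem_pi, Finset.coe_image, Finset.coe_univ, Set.image_univ, Set.mem_range,
      forall_exists_index, forall_apply_eq_imp_iff, Set.mem_setOf_eq]
    refine forall_congr' fun i => ?_
    have : (ρ.take i.1).length = i.1 := by simp
    rw [this]
    simp [eq_comm]
  have hmeas : @Measurable _ _ MeasurableSpace.pi playMS (playF (Γ := Γ)) := by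
    apply measurable_generateFrom
    rintro _ ⟨ρ, rfl⟩
    rw [hpre]
    exact MeasurableSet.pi (Finset.countable_toSet _) (fun _ _ => trivial)
  have hCyl : ∀ ρ : List Γ, @MeasurableSet _ playMS (Cyl ρ) := fun ρ =>
    MeasurableSpace.measurableSet_generateFrom ⟨ρ, rfl⟩
  refine ⟨@Measure.map _ _ MeasurableSpace.pi playMS playF ν, ?_, ?_⟩
  · exact @Measure.isProbabilityMeasure_map _ _ _ playMS _ _ _ (hmeas.aemeasurable)
  · intro ρ
    rw [@Measure.map_apply _ _ _ playMS _ _ hmeas _ (hCyl ρ), hpre]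
    rw [Measure.infinitePi_pi _ (fun _ _ => MeasurableSet.of_discrete)]
    rw [Finset.prod_image]
    · rw [prW_eq_prod, ENNReal.ofReal_prod_of_nonneg (fun i _ => PDist.nonneg _ _)]
      refine Finset.prod_congr rfl fun i _ => ?_
      rw [List.nil_append, ← distMeasure_singleton]
      congr 1
      ext c
      have : (ρ.take i.1).length = i.1 := by simp
      simp [eq_comm]
    · intro i _ j _ hij
      have := congrArg List.length hij
      simp only [List.length_take] at this
      ext
      omega

/-- Next-move law which first follows `τ`. -/
noncomputable def fullW (w : Hist Γ → PDist Γ) (τ : Hist Γ) (σ : Hist Γ) : PDist Γ :=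
  if hl : σ.length < τ.length then pointDist τ[σ.length] else w σ

lemma prW_fullW_ge (act : Γ → A) (α : Hist Γ → PDist A) (β : Hist Γ → A → PDist Γ)
    (hβ : IsEnvStrat act β) (τ : Hist Γ) (l : List Γ) : ∀ σ : Hist Γ, τ.length ≤ σ.length →
    prW (fullW (stepDist act α β hβ) τ) σ l = extProb act α β σ l := by
  induction l with
  | nil => intro σ _; simp [prW, extProb]
  | cons c l ih =>
    intro σ hσ
    rw [prW, extProb, ih _ (by simp; omega)]
    have : fullW (stepDist act α β hβ) τ σ = stepDist act α β hβ σ := by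
      rw [fullW, dif_neg (by omega)]
    rw [this]; rfl

lemma prW_fullW (act : Γ → A) (α : Hist Γ → PDist A) (β : Hist Γ → A → PDist Γ)
    (hβ : IsEnvStrat act β) (l : List Γ) : ∀ σ τ' : Hist Γ,
    prW (fullW (stepDist act α β hβ) (σ ++ τ')) σ l =
      if l <+: τ' then 1 else if τ' <+: l then extProb act α β (σ ++ τ') (l.drop τ'.length)
        else 0 := by
  induction l with
  | nil => intro σ τ'; simp [prW]
  | cons c l ih =>
    intro σ τ'
    cases τ' with
    | nil =>
      rw [prW_fullW_ge _ _ _ _ _ _ _ (by simp)]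
      simp
    | cons d τ' =>
      rw [prW]
      have h1 : fullW (stepDist act α β hβ) (σ ++ d :: τ') σ = pointDist d := by
        rw [fullW, dif_pos (by simp)]
        simp
      rw [h1]
      by_cases hcd : c = d
      · subst hcd
        have h2 := ih (σ ++ [c]) τ'
        simp only [List.append_assoc, List.singleton_append] at h2
        rw [h2]
        simp [pointDist, List.cons_prefix_cons]
      · simp [pointDist, hcd, List.cons_prefix_cons, Ne.symm hcd]

lemma exists_prMeasure (act : Γ → A) (α : Hist Γ → PDist A) (β : Hist Γ → A → PDist Γ)
    (hβ : IsEnvStrat act β) (τ : Hist Γ) : ∃ μ : Measure (Play Γ), IsPrMeasure act α β τ μ := by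
  obtain ⟨μ, h1, h2⟩ := exists_measure (fullW (stepDist act α β hβ) τ)
  refine ⟨μ, h1, fun ρ => ?_⟩
  rw [h2]
  have := prW_fullW act α β hβ ρ [] τ
  rw [List.nil_append] at this
  rw [this]
  split_ifs <;> simp

/-- Probability of not having reached the target after `n` more steps. -/
noncomputable def unr (act : Γ → A) (lam : Hist Γ → Bool) (α : Hist Γ → PDist A)
    (β : Hist Γ → A → PDist Γ) : ℕ → Hist Γ → ℝ
  | 0, τ => if lam τ = true then 0 else 1
  | n + 1, τ => ∑ c, (α τ).f (act c) * (β τ (act c)).f c * unr act lam α β n (τ ++ [c])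

lemma unr_nonneg (act : Γ → A) (lam : Hist Γ → Bool) (α : Hist Γ → PDist A)
    (β : Hist Γ → A → PDist Γ) (n : ℕ) : ∀ τ, 0 ≤ unr act lam α β n τ := by
  induction n with
  | zero => intro τ; rw [unr]; split_ifs <;> norm_num
  | succ n ih =>
    intro τ
    rw [unr]
    exact Finset.sum_nonneg fun c _ =>
      mul_nonneg (mul_nonneg ((α τ).nonneg _) ((β τ _).nonneg _)) (ih _)

lemma extProb_nonneg (act : Γ → A) (α : Hist Γ → PDist A)
    (β : Hist Γ → A → PDist Γ) (l : List Γ) : ∀ τ, 0 ≤ extProb act α β τ l := by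
  induction l with
  | nil => intro τ; simp [extProb]
  | cons c l ih =>
    intro τ
    rw [extProb]
    exact mul_nonneg (mul_nonneg ((α τ).nonneg _) ((β τ _).nonneg _)) (ih _)

lemma extProb_append (act : Γ → A) (α : Hist Γ → PDist A)
    (β : Hist Γ → A → PDist Γ) (c : Γ) (l : List Γ) : ∀ τ, extProb act α β τ (l ++ [c]) =
      extProb act α β τ l * ((α (τ ++ l)).f (act c) * (β (τ ++ l) (act c)).f c) := by
  induction l with
  | nil => intro τ; simp [extProb]
  | cons d l ih =>
    intro τ
    rw [List.cons_append, extProb, extProb, ih]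
    simp only [List.append_assoc, List.singleton_append]
    ring

/-- Plays which have not reached the target at time `n`. -/
def notR (lam : Hist Γ → Bool) (n : ℕ) : Set (Play Γ) :=
  {π | ¬ lam (List.ofFn fun i : Fin n => π i.1) = true}

lemma measurableSet_Cyl (ρ : List Γ) : MeasurableSet (Cyl ρ) :=
  MeasurableSpace.measurableSet_generateFrom ⟨ρ, rfl⟩

lemma measurableSet_notR (lam : Hist Γ → Bool) (n : ℕ) : MeasurableSet (notR lam n) := by
  have : notR lam n = ⋃ ρ ∈ {ρ : List Γ | ρ.length = n ∧ ¬ lam ρ = true}, Cyl ρ := by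
    ext π
    simp only [Set.mem_iUnion, Set.mem_setOf_eq, exists_prop, notR]
    constructor
    · intro hp
      refine ⟨_, ⟨by simp, hp⟩, ?_⟩
      rw [mem_Cyl_iff_ofFn]
      simp
    · rintro ⟨ρ, ⟨rfl, h2⟩, h3⟩
      rw [mem_Cyl_iff_ofFn] at h3
      rwa [h3]
  rw [this]
  exact MeasurableSet.biUnion (Set.to_countable _) fun ρ _ => measurableSet_Cyl ρ

lemma antitone_notR (lam : Hist Γ → Bool) (habs : Absorbing lam) : Antitone (notR lam) := by
  apply antitone_nat_of_succ_le
  intro n π hp hq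
  apply hp
  rw [List.ofFn_succ_last]
  exact habs _ _ hq

lemma measure_notR (act : Γ → A) (lam : Hist Γ → Bool) (α : Hist Γ → PDist A)
    (β : Hist Γ → A → PDist Γ) (τ : Hist Γ) (μ : Measure (Play Γ))
    (hμ : IsPrMeasure act α β τ μ) (n : ℕ) : ∀ l : List Γ,
    ENNReal.ofReal (extProb act α β τ l * unr act lam α β n (τ ++ l)) =
      μ (Cyl (τ ++ l) ∩ notR lam ((τ ++ l).length + n)) := by
  have hc : ∀ l, μ (Cyl (τ ++ l)) = ENNReal.ofReal (extProb act α β τ l) := by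
    intro l
    rw [hμ.2]
    by_cases hl : l = []
    · subst hl; simp [extProb]
    · have : ¬ (τ ++ l) <+: τ := by
        intro hp
        have := hp.length_le
        simp at this
        exact hl this
      simp [this]
  induction n with
  | zero =>
    intro l
    rw [unr]
    have key : ∀ π ∈ Cyl (τ ++ l), (π ∈ notR lam ((τ ++ l).length + 0) ↔
        ¬ lam (τ ++ l) = true) := by
      intro π hp
      rw [mem_Cyl_iff_ofFn] at hp
      rw [Nat.add_zero, notR, Set.mem_setOf_eq, hp]
    by_cases hl : lam (τ ++ l) = true
    · have : Cyl (τ ++ l) ∩ notR lam ((τ ++ l).length + 0) = ∅ := by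
        ext π
        simp only [Set.mem_inter_iff, Set.mem_empty_iff_false, iff_false, not_and]
        intro hp hq
        exact (key π hp).1 hq hl
      rw [this]
      simp [hl]
    · have : Cyl (τ ++ l) ∩ notR lam ((τ ++ l).length + 0) = Cyl (τ ++ l) := by
        apply Set.inter_eq_left.2
        intro π hp
        exact (key π hp).2 hl
      rw [this, hc]
      simp [hl]
  | succ n ih =>
    intro l
    have hU : Cyl (τ ++ l) ∩ notR lam ((τ ++ l).length + (n + 1)) =
        ⋃ c ∈ (Finset.univ : Finset Γ),
          (Cyl (τ ++ (l ++ [c])) ∩ notR lam ((τ ++ (l ++ [c])).length + n)) := by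
      ext π
      have hlen : ∀ c : Γ, (τ ++ l ++ [c]).length + n = (τ ++ l).length + (n + 1) := by
        intro c; rw [List.length_append, List.length_singleton]; omega
      simp only [hlen, Set.mem_inter_iff, Set.mem_iUnion, Finset.mem_univ, exists_prop, true_and,
        ← List.append_assoc τ l, mem_Cyl_append]
      constructor
      · rintro ⟨h1, h2⟩
        exact ⟨_, ⟨h1, rfl⟩, h2⟩
      · rintro ⟨c, ⟨h1, _⟩, h2⟩
        exact ⟨h1, h2⟩
    rw [hU, measure_biUnion_finset]
    · simp_rw [← ih]
      rw [← ENNReal.ofReal_sum_of_nonneg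
        (fun c _ => mul_nonneg (extProb_nonneg _ _ _ _ _) (unr_nonneg _ _ _ _ _ _))]
      rw [unr, Finset.mul_sum]
      congr 1
      refine Finset.sum_congr rfl fun c _ => ?_
      rw [extProb_append, List.append_assoc]
      ring
    · intro c _ d _ hcd
      refine Set.disjoint_left.2 fun π h1 h2 => hcd ?_
      have h1 := h1.1
      have h2 := h2.1
      rw [← List.append_assoc, mem_Cyl_append] at h1 h2
      rw [← h1.2, ← h2.2]
    · intro c _
      exact (measurableSet_Cyl _).inter (measurableSet_notR _ _)

/-- Combinatorial version of almost-sure winning. -/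
def WinC (act : Γ → A) (sim : Hist Γ → Hist Γ → Prop) (lam : Hist Γ → Bool)
    (α : Hist Γ → PDist A) (τ : Hist Γ) : Prop :=
  ∀ τ' : Hist Γ, sim τ' τ → ∀ β : Hist Γ → A → PDist Γ, IsEnvStrat act β →
    Filter.Tendsto (fun n => unr act lam α β n τ') Filter.atTop (nhds 0)

lemma WinC_of_ASWinFrom (act : Γ → A) (sim : Hist Γ → Hist Γ → Prop) (lam : Hist Γ → Bool)
    (habs : Absorbing lam) (α : Hist Γ → PDist A) (τ : Hist Γ)
    (hw : ASWinFrom act sim lam α τ) : WinC act sim lam α τ := by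
  intro τ' hτ' β hβ
  obtain ⟨μ, hμ⟩ := exists_prMeasure act α β hβ τ'
  have hR := hw τ' hτ' β hβ μ hμ
  haveI := hμ.1
  have hcompl : ⋂ n, notR lam n = (ReachEvent lam)ᶜ := by
    ext π
    simp [notR, ReachEvent]
  have hmR : MeasurableSet (ReachEvent lam) := by
    rw [← MeasurableSet.compl_iff, ← hcompl]
    exact MeasurableSet.iInter fun n => measurableSet_notR lam n
  have h0 : μ (⋂ n, notR lam n) = 0 := by
    rw [hcompl, prob_compl_eq_zero_iff hmR, hR]
  have ht := tendsto_measure_iInter_atTop (μ := μ)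
    (fun n => (measurableSet_notR lam n).nullMeasurableSet) (antitone_notR lam habs)
    ⟨0, measure_ne_top _ _⟩
  rw [h0] at ht
  have ht2 := (Filter.tendsto_add_atTop_iff_nat τ'.length).2 ht
  have ht3 := (ENNReal.tendsto_toReal ENNReal.zero_ne_top).comp ht2
  rw [ENNReal.toReal_zero] at ht3
  refine squeeze_zero (fun n => unr_nonneg _ _ _ _ _ _) (fun n => ?_) ht3
  have hm := measure_notR act lam α β τ' μ hμ n []
  simp only [extProb, one_mul, List.append_nil] at hm
  have hle : ENNReal.ofReal (unr act lam α β n τ') ≤ μ (notR lam (n + τ'.length)) := by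
    rw [hm, add_comm]
    exact measure_mono Set.inter_subset_right
  exact (ENNReal.ofReal_le_iff_le_toReal (measure_ne_top _ _)).1 hle

lemma unr_congr (act : Γ → A) (lam : Hist Γ → Bool) (α : Hist Γ → PDist A)
    (β β' : Hist Γ → A → PDist Γ) (k : ℕ) (hk : ∀ ρ : Hist Γ, k ≤ ρ.length → β ρ = β' ρ)
    (n : ℕ) : ∀ τ : Hist Γ, k ≤ τ.length → unr act lam α β n τ = unr act lam α β' n τ := by
  induction n with
  | zero => intro τ _; simp [unr]
  | succ n ih =>
    intro τ hτ
    rw [unr, unr]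
    refine Finset.sum_congr rfl fun c _ => ?_
    rw [hk τ hτ, ih (τ ++ [c]) (by simp; omega)]

lemma WinC_step (act : Γ → A) (sim : Hist Γ → Hist Γ → Prop) (hsim : IsIndist act sim)
    (lam : Hist Γ → Bool) (α : Hist Γ → PDist A) (hα : IsPlayerStrat sim α) (τ : Hist Γ) (c : Γ)
    (hw : WinC act sim lam α τ) (hc : 0 < (α τ).f (act c)) :
    WinC act sim lam α (τ ++ [c]) := by
  intro ρ hρ β hβ
  have hne : ρ ≠ [] := by
    rintro rfl
    have := hsim.length_eq _ _ hρ
    simp at this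
  obtain ⟨τ', c', rfl⟩ : ∃ τ' c', ρ = τ' ++ [c'] :=
    ⟨ρ.dropLast, ρ.getLast hne, (List.dropLast_append_getLast hne).symm⟩
  obtain ⟨h1, h2⟩ := hsim.prefix_act _ _ _ _ hρ
  let β' : Hist Γ → A → PDist Γ := fun σ a =>
    if σ = τ' ∧ a = act c' then pointDist c' else β σ a
  have hβ' : IsEnvStrat act β' := by
    intro σ a d hd
    by_cases hs : σ = τ' ∧ a = act c'
    · simp only [β', if_pos hs, pointDist] at hd
      by_cases hdc : d = c'
      · rw [hdc, hs.2]
      · simp [hdc] at hd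
    · simp only [β', if_neg hs] at hd
      exact hβ σ a d hd
  have ht := hw τ' h1 β' hβ'
  have ht2 := (Filter.tendsto_add_atTop_iff_nat 1).2 ht
  have hpos : 0 < (α τ').f (act c') := by rw [hα _ _ h1, h2]; exact hc
  have ht3 := ht2.const_mul ((α τ').f (act c'))⁻¹
  rw [mul_zero] at ht3
  refine squeeze_zero (fun n => unr_nonneg _ _ _ _ _ _) (fun n => ?_) ht3
  have hle : (α τ').f (act c') * (β' τ' (act c')).f c' * unr act lam α β' n (τ' ++ [c'])
      ≤ unr act lam α β' (n + 1) τ' := by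
    rw [unr]
    exact Finset.single_le_sum
      (f := fun d => (α τ').f (act d) * (β' τ' (act d)).f d * unr act lam α β' n (τ' ++ [d]))
      (fun d _ => mul_nonneg (mul_nonneg ((α τ').nonneg _) ((β' τ' _).nonneg _))
        (unr_nonneg _ _ _ _ _ _)) (Finset.mem_univ c')
  have hb : (β' τ' (act c')).f c' = 1 := by simp [β', pointDist]
  have hu : unr act lam α β n (τ' ++ [c']) = unr act lam α β' n (τ' ++ [c']) := by
    apply unr_congr act lam α β β' (τ'.length + 1)
    · intro σ hσ
      funext a
      have : ¬ (σ = τ' ∧ a = act c') := by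
        rintro ⟨rfl, _⟩; omega
      simp only [β', if_neg this]
    · simp
  rw [hb, mul_one] at hle
  rw [hu, inv_mul_eq_div, le_div_iff₀ hpos, mul_comm]
  exact hle

/-- If the environment can preserve an invariant of non-target histories, the player never wins. -/
lemma no_win (act : Γ → A) (hact : Function.Surjective act)
    (sim : Hist Γ → Hist Γ → Prop) (hsim : IsIndist act sim)
    (lam : Hist Γ → Bool) (α : Hist Γ → PDist A) (N : Hist Γ → Prop)
    (hlam : ∀ τ, N τ → ¬ lam τ = true)
    (hstep : ∀ τ, N τ → ∀ a, 0 < (α τ).f a → ∃ c, act c = a ∧ N (τ ++ [c]))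
    (τ : Hist Γ) (hN : N τ) : ¬ WinC act sim lam α τ := by
  intro hw
  have hg : ∀ (σ : Hist Γ) (a : A), ∃ c, act c = a ∧
      (N σ → 0 < (α σ).f a → N (σ ++ [c])) := by
    intro σ a
    by_cases hs : N σ ∧ 0 < (α σ).f a
    · obtain ⟨c, h1, h2⟩ := hstep σ hs.1 a hs.2
      exact ⟨c, h1, fun _ _ => h2⟩
    · obtain ⟨c, h1⟩ := hact a
      exact ⟨c, h1, fun h2 h3 => (hs ⟨h2, h3⟩).elim⟩
  choose g hg1 hg2 using hg
  let β : Hist Γ → A → PDist Γ := fun σ a => pointDist (g σ a)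
  have hsup : ∀ σ a c, (β σ a).f c ≠ 0 → c = g σ a := by
    intro σ a c hc
    by_contra hne
    exact hc (by simp [β, pointDist, hne])
  have hβ : IsEnvStrat act β := by
    intro σ a c hc
    rw [hsup σ a c hc.ne']
    exact hg1 σ a
  have hone : ∀ n σ, N σ → unr act lam α β n σ = 1 := by
    intro n
    induction n with
    | zero => intro σ hσ; simp [unr, hlam σ hσ]
    | succ n ih =>
      intro σ hσ
      rw [unr, ← (stepDist act α β hβ σ).sum_one]
      refine Finset.sum_congr rfl fun c _ => ?_
      change _ = (α σ).f (act c) * (β σ (act c)).f c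
      by_cases hz : (α σ).f (act c) * (β σ (act c)).f c = 0
      · rw [hz, zero_mul]
      · have h1 : (α σ).f (act c) ≠ 0 := left_ne_zero_of_mul hz
        have h2 := hsup _ _ _ (right_ne_zero_of_mul hz)
        have h3 := hg2 σ (act c) hσ (lt_of_le_of_ne ((α σ).nonneg _) h1.symm)
        rw [← h2] at h3
        rw [ih _ h3, mul_one]
  have ht := hw τ (hsim.equiv.refl τ) β hβ
  simp only [hone _ τ hN] at ht
  exact one_ne_zero (tendsto_nhds_unique tendsto_const_nhds ht)

end Aux

/-- Lemma 3: P_∃ ⊆ Y* ∩ P. -/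
theorem Pexists_subset_Ystar {Γ A P : Type} [Fintype Γ] [Nonempty Γ] [Fintype A] [Nonempty A] [Fintype P]
    (act : Γ → A) (hact : Function.Surjective act)
    (sim : Hist Γ → Hist Γ → Prop) (hsim : IsIndist act sim)
    (lam : Hist Γ → Bool) (hcons : InfoConsistent sim lam) (habs : Absorbing lam)
    (h : Hist Γ → P) (hh : IsRectMorphism sim lam h)
    (δP : P → Γ → P) (hδ : ∀ (τ : Hist Γ) (c : Γ), δP (h τ) c = h (τ ++ [c])) :
    Pexists act sim lam h ⊆ {p : P | Sum.inl p ∈ Ystar sim h act δP lam} := by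
  -- the candidate post-fixpoint
  let Y : Set (P ⊕ P × A) := fun s => match s with
    | Sum.inl p => ∃ τ, h τ = p ∧ ∃ α, IsPlayerStrat sim α ∧ WinC act sim lam α τ
    | Sum.inr (p, a) => ∃ τ, h τ = p ∧ ∃ α, IsPlayerStrat sim α ∧ WinC act sim lam α τ ∧
        0 < (α τ).f a
  have hsat : ∀ τ τ' α, sim τ' τ → WinC act sim lam α τ → WinC act sim lam α τ' :=
    fun τ τ' α hs hw ρ hρ => hw ρ (hsim.equiv.trans hρ hs)
  have hrect : ∀ p' τ, approx sim h p' (h τ) → ∃ τ', sim τ' τ ∧ h τ' = p' := by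
    rintro p' τ ⟨τ1, τ2, h1, rfl, h2⟩
    have : h τ1 ∈ h '' InfoSet sim τ := by
      rw [← hh.rect _ _ h2]
      exact ⟨τ1, h1, rfl⟩
    exact this
  have hint : Y ⊆ intr (approxS sim h) Y := by
    rintro (p | ⟨p, a⟩) hs (p' | ⟨p', a'⟩) hr
    · obtain ⟨τ, rfl, α, hα, hw⟩ := hs
      obtain ⟨τ', h1, h2⟩ := hrect p' τ hr
      exact ⟨τ', h2, α, hα, hsat _ _ _ h1 hw⟩
    · exact hr.elim
    · exact hr.elim
    · obtain ⟨τ, rfl, α, hα, hw, hp⟩ := hs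
      obtain ⟨hr, rfl⟩ := hr
      obtain ⟨τ', h1, h2⟩ := hrect p' τ hr
      exact ⟨τ', h2, α, hα, hsat _ _ _ h1 hw, by rw [hα _ _ h1]; exact hp⟩
  let X : Set (P ⊕ P × A) := OrderHom.lfp (innerOp sim h act δP lam Y)
  have hX : ∀ s, s ∈ Y → (s ∈ Pre act δP X ∨ s ∈ targetS A lam h) → s ∈ X := by
    intro s hs hs'
    have hfix : innerOp sim h act δP lam Y X = X := OrderHom.map_lfp _
    rw [← hfix]
    exact ⟨hint hs, hs'⟩
  have hP : ∀ τ α, IsPlayerStrat sim α → WinC act sim lam α τ → Sum.inl (h τ) ∈ X := by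
    intro τ α hα hw
    by_contra hn
    refine no_win act hact sim hsim lam α
      (fun σ => WinC act sim lam α σ ∧ Sum.inl (h σ) ∉ X) ?_ ?_ τ ⟨hw, hn⟩ hw
    · rintro σ ⟨h1, h2⟩ hl
      exact h2 (hX _ ⟨σ, rfl, α, hα, h1⟩ (Or.inr ⟨h σ, ⟨σ, rfl, hl⟩, rfl⟩))
    · rintro σ ⟨h1, h2⟩ a ha
      by_contra hno
      apply h2
      refine hX _ ⟨σ, rfl, α, hα, h1⟩ (Or.inl ⟨a, ?_⟩)
      refine hX _ ⟨σ, rfl, α, hα, h1, ha⟩ (Or.inl ?_)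
      intro c hc
      by_contra hcX
      rw [hδ] at hcX
      exact hno ⟨c, hc, WinC_step act sim hsim lam α hα σ c h1 (by rw [hc]; exact ha), hcX⟩
  have hYX : Y ≤ outerOp sim h act δP lam Y := by
    rintro (p | ⟨p, a⟩) hs
    · obtain ⟨τ, rfl, α, hα, hw⟩ := hs
      exact hP τ α hα hw
    · refine hX _ hs (Or.inl ?_)
      obtain ⟨τ, rfl, α, hα, hw, hp⟩ := hs
      intro c hc
      rw [hδ]
      exact hP _ α hα (WinC_step act sim hsim lam α hα τ c hw (by rw [hc]; exact hp))
  rintro p ⟨τ, rfl, α, hα, hw⟩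
  exact OrderHom.le_gfp _ hYX ⟨τ, rfl, α, hα, WinC_of_ASWinFrom act sim lam habs α τ hw⟩
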